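/- Let ρ ∈ [0,1], m̂ > 0 and χ̂ > 0. Let x⁰ be distributed according to the Bernoulli–Gaussian measure μ_ρ and let z be an independent standard Gaussian random variable. Then E[ (x⁰ − x̂(√χ̂·z + m̂·x⁰; m̂))² ] = ρ − 4ρ·𝒬(1/√(χ̂ + m̂²)) − (2(1−ρ)/m̂²)·r(χ̂) − (2ρ/m̂²)·r(χ̂ + m̂²). -/

import Mathlib

open MeasureTheory ProbabilityTheory

/-- Standard Gaussian tail function `𝒬(x) = ∫_x^∞ e^{−z²/2}/√(2π) dz`. -/
noncomputable def gaussQ (x : ℝ) : ℝ :=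
  ∫ z in Set.Ioi x, Real.exp (-z ^ 2 / 2) / Real.sqrt (2 * Real.pi)

/-- `r(h) = √(h/(2π))·e^{−1/(2h)} − (1+h)·𝒬(1/√h)`. -/
noncomputable def rFun (h : ℝ) : ℝ :=
  Real.sqrt (h / (2 * Real.pi)) * Real.exp (-1 / (2 * h)) - (1 + h) * gaussQ (1 / Real.sqrt h)

/-- Soft-thresholding function: `x̂(y; Q̂)`. -/
noncomputable def softThresh (y Qh : ℝ) : ℝ :=
  if 1 < y then (y - 1) / Qh else if y < -1 then (y + 1) / Qh else 0

/-- Bernoulli–Gaussian measure `μ_ρ = (1−ρ)·δ₀ + ρ·N(0,1)` on `ℝ`. -/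
noncomputable def bgMeasure (ρ : ℝ) : Measure ℝ :=
  ENNReal.ofReal (1 - ρ) • Measure.dirac (0 : ℝ) + ENNReal.ofReal ρ • gaussianReal 0 1

namespace GaussianSoftThreshold

/-- The standard Gaussian density, in the normalisation used by `gaussQ`. -/
noncomputable def gaussDensity (x : ℝ) : ℝ :=
  Real.exp (-x ^ 2 / 2) / Real.sqrt (2 * Real.pi)

lemma integral_gaussian_eq (f : ℝ → ℝ) :
    ∫ x, f x ∂(gaussianReal 0 1) = ∫ x, f x * gaussDensity x := by
  rw [integral_gaussianReal_eq_integral_smul one_ne_zero]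
  refine integral_congr_ae (.of_forall fun x => ?_)
  simp only [gaussianPDFReal_def, gaussDensity, smul_eq_mul, NNReal.coe_one, mul_one, sub_zero]
  ring

lemma integrable_pow_mul_gaussDensity (n : ℕ) :
    Integrable fun x : ℝ => x ^ n * gaussDensity x := by
  have h := (integrable_rpow_mul_exp_neg_mul_sq (b := 1 / 2) (by norm_num) (s := n)
    (by have : (0 : ℝ) ≤ n := n.cast_nonneg
        linarith)).div_const (Real.sqrt (2 * Real.pi))
  refine h.congr (.of_forall fun x => ?_)
  simp only [gaussDensity, Real.rpow_natCast]
  rw [mul_div_assoc, show -(1 / 2) * x ^ 2 = -x ^ 2 / 2 by ring]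

lemma integrable_gaussDensity : Integrable gaussDensity := by
  simpa using integrable_pow_mul_gaussDensity 0

lemma integrable_id_mul_gaussDensity : Integrable fun x : ℝ => x * gaussDensity x := by
  simpa using integrable_pow_mul_gaussDensity 1

lemma hasDerivAt_gaussDensity (x : ℝ) : HasDerivAt gaussDensity (-x * gaussDensity x) x := by
  have h : HasDerivAt (fun x : ℝ => -x ^ 2 / 2) (-x) x := by
    refine (((hasDerivAt_pow 2 x).neg).div_const 2).congr_deriv ?_
    norm_num
    ring
  refine (h.exp.div_const (Real.sqrt (2 * Real.pi))).congr_deriv ?_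
  simp only [gaussDensity]
  ring

/-- Integration by parts against an affine function on a half-line. -/
lemma setIntegral_Ioi_affine (t c : ℝ) :
    ∫ x in Set.Ioi t, (x * (x + c) - 1) * gaussDensity x = (t + c) * gaussDensity t := by
  have hd (x : ℝ) : HasDerivAt (fun x => -((x + c) * gaussDensity x))
      ((x * (x + c) - 1) * gaussDensity x) x := by
    refine (((hasDerivAt_id' x).add_const c).mul (hasDerivAt_gaussDensity x)).neg.congr_deriv ?_
    ring
  have hi' : Integrable fun x => (x * (x + c) - 1) * gaussDensity x := by
    refine (((integrable_pow_mul_gaussDensity 2).add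
      (integrable_id_mul_gaussDensity.const_mul c)).sub integrable_gaussDensity).congr
      (.of_forall fun x => ?_)
    simp only [Pi.add_apply, Pi.sub_apply]
    ring
  have hi : Integrable fun x => -((x + c) * gaussDensity x) := by
    refine (integrable_id_mul_gaussDensity.add (integrable_gaussDensity.const_mul c)).neg.congr
      (.of_forall fun x => ?_)
    simp only [Pi.add_apply, Pi.neg_apply]
    ring
  rw [integral_Ioi_of_hasDerivAt_of_tendsto (hd t).continuousAt.continuousWithinAt
    (fun x _ => hd x) hi'.integrableOn
    (tendsto_zero_of_hasDerivAt_of_integrableOn_Ioi (a := t) (fun x _ => hd x) hi'.integrableOn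
      hi.integrableOn)]
  ring

lemma integral_tail (t : ℝ) :
    ∫ x, (if t < x then 1 else 0 : ℝ) ∂(gaussianReal 0 1) = gaussQ t := by
  rw [integral_gaussian_eq, gaussQ, ← integral_indicator measurableSet_Ioi]
  refine integral_congr_ae (.of_forall fun x => ?_)
  by_cases h : t < x <;> simp [h, gaussDensity]

lemma integral_id_mul_posPart (t : ℝ) :
    ∫ x, x * max (x - t) 0 ∂(gaussianReal 0 1) = gaussQ t := by
  have h := setIntegral_Ioi_affine t (-t)
  have e : ∫ x in Set.Ioi t, (x * (x + -t) - 1) * gaussDensity x =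
      (∫ x in Set.Ioi t, x * (x - t) * gaussDensity x) - gaussQ t := by
    rw [gaussQ, ← integral_sub]
    · refine integral_congr_ae (.of_forall fun x => ?_)
      simp only [gaussDensity]
      ring
    · refine (((integrable_pow_mul_gaussDensity 2).sub
        (integrable_id_mul_gaussDensity.const_mul t)).congr
        (.of_forall fun x => ?_)).integrableOn
      simp only [Pi.sub_apply]
      ring
    · exact integrable_gaussDensity.integrableOn
  rw [e] at h
  rw [integral_gaussian_eq]
  have e2 : ∫ x, x * max (x - t) 0 * gaussDensity x =
      ∫ x in Set.Ioi t, x * (x - t) * gaussDensity x := by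
    rw [← integral_indicator measurableSet_Ioi]
    refine integral_congr_ae (.of_forall fun x => ?_)
    by_cases h : t < x
    · simp [h, max_eq_left (sub_pos.2 h).le]
    · simp [h, max_eq_right (sub_nonpos.2 (not_lt.1 h))]
  rw [e2]
  linarith

lemma integral_posPart_sq (t : ℝ) :
    ∫ x, max (x - t) 0 ^ 2 ∂(gaussianReal 0 1) =
      (1 + t ^ 2) * gaussQ t - t * gaussDensity t := by
  have h := setIntegral_Ioi_affine t (-2 * t)
  have e : ∫ x in Set.Ioi t, (x * (x + -2 * t) - 1) * gaussDensity x =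
      (∫ x in Set.Ioi t, (x - t) ^ 2 * gaussDensity x) - (1 + t ^ 2) * gaussQ t := by
    rw [gaussQ, ← integral_const_mul, ← integral_sub]
    · refine integral_congr_ae (.of_forall fun x => ?_)
      simp only [gaussDensity]
      ring
    · refine ((((integrable_pow_mul_gaussDensity 2).sub
        (integrable_id_mul_gaussDensity.const_mul (2 * t))).add
        (integrable_gaussDensity.const_mul (t ^ 2))).congr
        (.of_forall fun x => ?_)).integrableOn
      simp only [Pi.sub_apply, Pi.add_apply]
      ring
    · exact (integrable_gaussDensity.const_mul _).integrableOn
  rw [e] at h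
  rw [integral_gaussian_eq]
  have e2 : ∫ x, max (x - t) 0 ^ 2 * gaussDensity x =
      ∫ x in Set.Ioi t, (x - t) ^ 2 * gaussDensity x := by
    rw [← integral_indicator measurableSet_Ioi]
    refine integral_congr_ae (.of_forall fun x => ?_)
    by_cases h : t < x
    · simp [h, max_eq_left (sub_pos.2 h).le]
    · simp [h, max_eq_right (sub_nonpos.2 (not_lt.1 h))]
  rw [e2]
  linarith

lemma max_affine_eq {m : ℝ} (hm : 0 < m) (a x : ℝ) :
    max (a + m * x - 1) 0 = m * max (x - (1 - a) / m) 0 := by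
  rw [mul_max_of_nonneg _ _ hm.le, mul_zero]
  congr 1
  field_simp
  ring

lemma integral_tail_affine {m : ℝ} (hm : 0 < m) (a : ℝ) :
    ∫ x, (if 1 < a + m * x then 1 else 0 : ℝ) ∂(gaussianReal 0 1) = gaussQ ((1 - a) / m) := by
  rw [← integral_tail]
  refine integral_congr_ae (.of_forall fun x => ?_)
  have : 1 < a + m * x ↔ (1 - a) / m < x := by
    rw [div_lt_iff₀ hm]
    constructor <;> intro h <;> linarith
  simp only [this]

/-- Gaussian integration by parts for the positive part of an affine function. -/
lemma integral_id_mul_posPart_affine {m : ℝ} (hm : 0 < m) (a : ℝ) :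
    ∫ x, x * max (a + m * x - 1) 0 ∂(gaussianReal 0 1) =
      m * ∫ x, (if 1 < a + m * x then 1 else 0 : ℝ) ∂(gaussianReal 0 1) := by
  rw [integral_tail_affine hm, ← integral_id_mul_posPart, ← integral_const_mul]
  refine integral_congr_ae (.of_forall fun x => ?_)
  simp only [max_affine_eq hm]
  ring

lemma integral_posPart_scaled_sq {h : ℝ} (hh : 0 < h) :
    ∫ x, max (Real.sqrt h * x - 1) 0 ^ 2 ∂(gaussianReal 0 1) = -rFun h := by
  have hs : 0 < Real.sqrt h := Real.sqrt_pos.2 hh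
  have h2 : Real.sqrt h ^ 2 = h := Real.sq_sqrt hh.le
  have e : ∀ x, max (Real.sqrt h * x - 1) 0 ^ 2 = h * max (x - 1 / Real.sqrt h) 0 ^ 2 := by
    intro x
    have := max_affine_eq hs 0 x
    rw [zero_add, sub_zero] at this
    rw [this, mul_pow, h2]
  simp only [e]
  rw [integral_const_mul, integral_posPart_sq, rFun, gaussDensity, div_pow, h2,
    Real.sqrt_div hh.le, one_pow]
  have e3 : -(1 / h) / 2 = -1 / (2 * h) := by
    field_simp
  rw [e3]
  have e4 : h * (1 / Real.sqrt h) = Real.sqrt h := by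
    field_simp
    exact h2.symm
  have e5 : h * (1 + 1 / h) = 1 + h := by
    field_simp
    ring
  linear_combination (gaussQ (1 / Real.sqrt h)) * e5 -
    (Real.exp (-1 / (2 * h)) / Real.sqrt (2 * Real.pi)) * e4

lemma softThresh_eq (y m : ℝ) :
    softThresh y m = (max (y - 1) 0 - max (-y - 1) 0) / m := by
  unfold softThresh
  split_ifs with h1 h2
  · rw [max_eq_left (by linarith), max_eq_right (by linarith), sub_zero]
  · rw [max_eq_right (by linarith), max_eq_left (by linarith)]
    ring
  · rw [max_eq_right (by linarith), max_eq_right (by linarith)]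
    simp

lemma softThresh_sq_eq (y m : ℝ) :
    softThresh y m ^ 2 = (max (y - 1) 0 ^ 2 + max (-y - 1) 0 ^ 2) / m ^ 2 := by
  have h0 : max (y - 1) 0 * max (-y - 1) 0 = 0 := by
    rcases le_total y 1 with h | h
    · rw [max_eq_right (by linarith : y - 1 ≤ 0), zero_mul]
    · rw [max_eq_right (by linarith : -y - 1 ≤ 0), mul_zero]
  rw [softThresh_eq, div_pow]
  congr 1
  linear_combination -2 * h0

lemma memLp_id : MemLp (fun x : ℝ => x) 2 (gaussianReal 0 1) := by
  simpa [Function.id_def] using memLp_id_gaussianReal (μ := 0) (v := 1) 2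

lemma memLp_posPart {Ω : Type*} [MeasurableSpace Ω] {P : Measure Ω} [IsFiniteMeasure P]
    {Y : Ω → ℝ} (hY : MemLp Y 2 P) : MemLp (fun ω => max (Y ω - 1) 0) 2 P :=
  (hY.sub (memLp_const 1)).pos_part

lemma memLp_softThresh {Ω : Type*} [MeasurableSpace Ω] {P : Measure Ω} [IsFiniteMeasure P]
    {Y : Ω → ℝ} (hY : MemLp Y 2 P) (m : ℝ) : MemLp (fun ω => softThresh (Y ω) m) 2 P := by
  simp only [softThresh_eq, div_eq_inv_mul]
  exact ((memLp_posPart hY).sub (memLp_posPart hY.neg)).const_mul _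

lemma map_neg_gaussian :
    MeasurePreserving (fun x : ℝ => -x) (gaussianReal 0 1) (gaussianReal 0 1) :=
  ⟨measurable_neg, by simpa using gaussianReal_map_neg (μ := 0) (v := 1)⟩

lemma integral_comp_neg_gaussian (f : ℝ → ℝ) :
    ∫ x, f (-x) ∂(gaussianReal 0 1) = ∫ x, f x ∂(gaussianReal 0 1) :=
  map_neg_gaussian.integral_comp (MeasurableEquiv.neg ℝ).measurableEmbedding f

lemma integral_softThresh_sq {h : ℝ} (hh : 0 < h) (m : ℝ) :
    ∫ x, softThresh (Real.sqrt h * x) m ^ 2 ∂(gaussianReal 0 1) = -(2 / m ^ 2) * rFun h := by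
  simp only [softThresh_sq_eq]
  have hL : MemLp (fun x : ℝ => Real.sqrt h * x) 2 (gaussianReal 0 1) := memLp_id.const_mul _
  have hLn : MemLp (fun x : ℝ => -(Real.sqrt h * x)) 2 (gaussianReal 0 1) := hL.neg
  rw [integral_div, integral_add (memLp_posPart hL).integrable_sq
    (memLp_posPart hLn).integrable_sq]
  have := integral_comp_neg_gaussian (fun x => max (Real.sqrt h * x - 1) 0 ^ 2)
  simp only [mul_neg] at this
  rw [this, integral_posPart_scaled_sq hh]
  ring

lemma map_linear_gaussian {χ : ℝ} (hχ : 0 ≤ χ) (m : ℝ) :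
    Measure.map (fun p : ℝ × ℝ => Real.sqrt χ * p.2 + m * p.1)
        ((gaussianReal 0 1).prod (gaussianReal 0 1)) =
      Measure.map (fun x => Real.sqrt (χ + m ^ 2) * x) (gaussianReal 0 1) := by
  have h := gaussianReal_add_gaussianReal_of_indepFun
    (indepFun_prod (μ := gaussianReal 0 1) (ν := gaussianReal 0 1)
      (X := fun x => m * x) (Y := fun x => Real.sqrt χ * x) (by fun_prop) (by fun_prop))
    (m₁ := m * 0) (m₂ := Real.sqrt χ * 0)
    (v₁ := NNReal.mk (m ^ 2) (sq_nonneg _) * 1)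
    (v₂ := NNReal.mk (Real.sqrt χ ^ 2) (sq_nonneg _) * 1)
    (by
      rw [← gaussianReal_map_const_mul, ← Function.comp_def (fun x => m * x) Prod.fst,
        ← Measure.map_map (by fun_prop) measurable_fst, Measure.map_fst_prod]
      simp)
    (by
      rw [← gaussianReal_map_const_mul, ← Function.comp_def (fun x => Real.sqrt χ * x) Prod.snd,
        ← Measure.map_map (by fun_prop) measurable_snd, Measure.map_snd_prod]
      simp)
  rw [gaussianReal_map_const_mul]
  convert h using 2
  · ext p
    simp [add_comm]
  · simp
  · ext
    simp [Real.sq_sqrt hχ, Real.sq_sqrt (add_nonneg hχ (sq_nonneg m)), add_comm]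

lemma integral_comp_linear {χ : ℝ} (hχ : 0 ≤ χ) (m : ℝ) {f : ℝ → ℝ} (hf : Measurable f) :
    ∫ p : ℝ × ℝ, f (Real.sqrt χ * p.2 + m * p.1) ∂((gaussianReal 0 1).prod (gaussianReal 0 1)) =
      ∫ x, f (Real.sqrt (χ + m ^ 2) * x) ∂(gaussianReal 0 1) := by
  rw [← integral_map (f := f) (φ := fun p : ℝ × ℝ => Real.sqrt χ * p.2 + m * p.1)
    (by fun_prop) hf.aestronglyMeasurable, map_linear_gaussian hχ,
    integral_map (by fun_prop) hf.aestronglyMeasurable]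

lemma memLp_linear (χ m : ℝ) :
    MemLp (fun p : ℝ × ℝ => Real.sqrt χ * p.2 + m * p.1) 2
        ((gaussianReal 0 1).prod (gaussianReal 0 1)) :=
  ((memLp_id.comp_snd _).const_mul _).add ((memLp_id.comp_fst _).const_mul _)

lemma measurable_softThresh (m : ℝ) : Measurable fun y => softThresh y m := by
  simp only [softThresh_eq]
  fun_prop

lemma integrable_fst_mul_posPart (χ m : ℝ) :
    Integrable (fun p : ℝ × ℝ => p.1 * max (Real.sqrt χ * p.2 + m * p.1 - 1) 0)
        ((gaussianReal 0 1).prod (gaussianReal 0 1)) :=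
  (memLp_id.comp_fst _).integrable_mul (memLp_posPart (memLp_linear χ m))

lemma integral_fst_mul_posPart {χ m : ℝ} (hχ : 0 ≤ χ) (hm : 0 < m) :
    ∫ p : ℝ × ℝ, p.1 * max (Real.sqrt χ * p.2 + m * p.1 - 1) 0
        ∂((gaussianReal 0 1).prod (gaussianReal 0 1)) =
      m * gaussQ (1 / Real.sqrt (χ + m ^ 2)) := by
  have hmeas : Measurable fun y : ℝ => (if 1 < y then 1 else 0 : ℝ) :=
    Measurable.ite measurableSet_Ioi measurable_const measurable_const
  have hs : 0 < Real.sqrt (χ + m ^ 2) := Real.sqrt_pos.2 (by positivity)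
  have hI : Integrable
      (fun p : ℝ × ℝ => (if 1 < Real.sqrt χ * p.2 + m * p.1 then 1 else 0 : ℝ))
          ((gaussianReal 0 1).prod (gaussianReal 0 1)) := by
    refine Integrable.of_bound (C := 1)
      (hmeas.comp (by fun_prop : Measurable
        fun p : ℝ × ℝ => Real.sqrt χ * p.2 + m * p.1)).aestronglyMeasurable
      (.of_forall fun p => ?_)
    split_ifs <;> simp
  rw [integral_prod_symm _ (integrable_fst_mul_posPart χ m)]
  simp only [integral_id_mul_posPart_affine hm]
  rw [integral_const_mul, ← integral_prod_symm _ hI, integral_comp_linear hχ m hmeas]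
  have := integral_tail_affine hs 0
  simp only [zero_add, sub_zero] at this
  rw [this]

lemma integral_fst_mul_softThresh {χ m : ℝ} (hχ : 0 ≤ χ) (hm : 0 < m) :
    ∫ p : ℝ × ℝ, p.1 * softThresh (Real.sqrt χ * p.2 + m * p.1) m
        ∂((gaussianReal 0 1).prod (gaussianReal 0 1)) =
      2 * gaussQ (1 / Real.sqrt (χ + m ^ 2)) := by
  have hY := memLp_linear χ m
  have hneg := (map_neg_gaussian.prod map_neg_gaussian).integral_comp
    ((MeasurableEquiv.neg ℝ).prodCongr (MeasurableEquiv.neg ℝ)).measurableEmbedding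
    (fun p : ℝ × ℝ => p.1 * max (Real.sqrt χ * p.2 + m * p.1 - 1) 0)
  have e (p : ℝ × ℝ) : p.1 * softThresh (Real.sqrt χ * p.2 + m * p.1) m =
      (p.1 * max (Real.sqrt χ * p.2 + m * p.1 - 1) 0 +
        (-p.1) * max (Real.sqrt χ * -p.2 + m * -p.1 - 1) 0) / m := by
    rw [softThresh_eq, show -(Real.sqrt χ * p.2 + m * p.1) - 1 =
      Real.sqrt χ * -p.2 + m * -p.1 - 1 by ring]
    ring
  have hi : Integrable
      (fun p : ℝ × ℝ => (-p.1) * max (Real.sqrt χ * -p.2 + m * -p.1 - 1) 0)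
          ((gaussianReal 0 1).prod (gaussianReal 0 1)) := by
    refine ((memLp_id.comp_fst (gaussianReal 0 1)).neg.integrable_mul
      (memLp_posPart hY.neg)).congr (.of_forall fun p => ?_)
    simp only [Pi.neg_apply, Pi.mul_apply]
    rw [show -(Real.sqrt χ * p.2 + m * p.1) - 1 =
      Real.sqrt χ * -p.2 + m * -p.1 - 1 by ring]
  simp only [e]
  rw [integral_div, integral_add (integrable_fst_mul_posPart χ m) hi]
  simp only [Prod.map_fst, Prod.map_snd] at hneg
  rw [hneg, integral_fst_mul_posPart hχ hm]
  field_simp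
  ring

lemma integral_fst_sq : ∫ p : ℝ × ℝ, p.1 ^ 2 ∂((gaussianReal 0 1).prod (gaussianReal 0 1)) = 1 := by
  rw [integral_fun_fst (fun x : ℝ => x ^ 2)]
  have h := variance_eq_integral (μ := gaussianReal 0 1) (X := id) aemeasurable_id
  rw [variance_id_gaussianReal] at h
  simpa using h.symm

lemma integral_error_gaussian {χ m : ℝ} (hχ : 0 < χ) (hm : 0 < m) :
    ∫ p : ℝ × ℝ, (p.1 - softThresh (Real.sqrt χ * p.2 + m * p.1) m) ^ 2
        ∂((gaussianReal 0 1).prod (gaussianReal 0 1)) =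
      1 - 4 * gaussQ (1 / Real.sqrt (χ + m ^ 2)) - (2 / m ^ 2) * rFun (χ + m ^ 2) := by
  have hX : MemLp (fun p : ℝ × ℝ => p.1) 2
      ((gaussianReal 0 1).prod (gaussianReal 0 1)) := memLp_id.comp_fst _
  have hS := memLp_softThresh (memLp_linear χ m) m
  have hXS : Integrable
      (fun p : ℝ × ℝ => p.1 * softThresh (Real.sqrt χ * p.2 + m * p.1) m)
          ((gaussianReal 0 1).prod (gaussianReal 0 1)) :=
    hX.integrable_mul hS
  have hsub : Integrable (fun p : ℝ × ℝ =>
      p.1 ^ 2 - 2 * (p.1 * softThresh (Real.sqrt χ * p.2 + m * p.1) m))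
          ((gaussianReal 0 1).prod (gaussianReal 0 1)) :=
    hX.integrable_sq.sub (hXS.const_mul 2)
  have e (p : ℝ × ℝ) : (p.1 - softThresh (Real.sqrt χ * p.2 + m * p.1) m) ^ 2 =
      p.1 ^ 2 - 2 * (p.1 * softThresh (Real.sqrt χ * p.2 + m * p.1) m) +
        softThresh (Real.sqrt χ * p.2 + m * p.1) m ^ 2 := by
    ring
  simp only [e]
  rw [integral_add hsub hS.integrable_sq,
    integral_sub hX.integrable_sq (hXS.const_mul 2), integral_const_mul, integral_fst_sq,
    integral_fst_mul_softThresh hχ.le hm,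
    integral_comp_linear hχ.le m ((measurable_softThresh m).pow_const 2),
    integral_softThresh_sq (by positivity)]
  ring

end GaussianSoftThreshold

open GaussianSoftThreshold in
/-- `E[(x⁰ − x̂(√χ̂·z + m̂·x⁰; m̂))²]
= ρ − 4ρ·𝒬(1/√(χ̂+m̂²)) − (2(1−ρ)/m̂²)·r(χ̂) − (2ρ/m̂²)·r(χ̂+m̂²)` for `x⁰ ~ μ_ρ` and
an independent standard Gaussian `z`. -/
theorem stmt_6 (ρ mh χh : ℝ) (hρ : ρ ∈ Set.Icc (0 : ℝ) 1) (hm : 0 < mh) (hχ : 0 < χh) :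
    ∫ p : ℝ × ℝ, (p.1 - softThresh (Real.sqrt χh * p.2 + mh * p.1) mh) ^ 2
        ∂((bgMeasure ρ).prod (gaussianReal 0 1)) =
      ρ - 4 * ρ * gaussQ (1 / Real.sqrt (χh + mh ^ 2)) -
        (2 * (1 - ρ) / mh ^ 2) * rFun χh - (2 * ρ / mh ^ 2) * rFun (χh + mh ^ 2) := by
  have hmeas : Measurable
      fun p : ℝ × ℝ => (p.1 - softThresh (Real.sqrt χh * p.2 + mh * p.1) mh) ^ 2 :=
    (measurable_fst.sub ((measurable_softThresh mh).comp (by fun_prop))).pow_const 2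
  have hpair : Measurable (Prod.mk (0 : ℝ) : ℝ → ℝ × ℝ) := measurable_prodMk_left
  have hi₀ : Integrable
      (fun p : ℝ × ℝ => (p.1 - softThresh (Real.sqrt χh * p.2 + mh * p.1) mh) ^ 2)
      (Measure.map (Prod.mk (0 : ℝ)) (gaussianReal 0 1)) := by
    rw [integrable_map_measure hmeas.aestronglyMeasurable hpair.aemeasurable]
    refine (memLp_softThresh (memLp_id.const_mul (Real.sqrt χh)) mh).integrable_sq.congr
      (.of_forall fun x => ?_)
    simp
  have hi₁ : Integrable
      (fun p : ℝ × ℝ => (p.1 - softThresh (Real.sqrt χh * p.2 + mh * p.1) mh) ^ 2)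
      ((gaussianReal 0 1).prod (gaussianReal 0 1)) :=
    ((memLp_id.comp_fst _).sub (memLp_softThresh (memLp_linear χh mh) mh)).integrable_sq
  rw [bgMeasure, Measure.add_prod, Measure.prod_smul_left, Measure.prod_smul_left,
    Measure.dirac_prod, integral_add_measure (hi₀.smul_measure ENNReal.ofReal_ne_top)
      (hi₁.smul_measure ENNReal.ofReal_ne_top), integral_smul_measure, integral_smul_measure,
    integral_error_gaussian hχ hm, integral_map hpair.aemeasurable hmeas.aestronglyMeasurable,
    ENNReal.toReal_ofReal (sub_nonneg.2 hρ.2), ENNReal.toReal_ofReal hρ.1]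
  simp only [mul_zero, add_zero, zero_sub, neg_sq, smul_eq_mul]
  rw [integral_softThresh_sq hχ]
  ring
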